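/- arXiv:1010.4189 — 2 statements merged into one kernel-verified Lean document; each statement's English description precedes it below -/
import Mathlib

section
/- Let A be an N×N complex matrix whose numerical shadow is rotation-invariant, i.e. for every θ ∈ ℝ the pushforward of the uniform probability measure μ on the unit sphere Ω_N of ℂ^N under u ↦ ⟨(e^{iθ}A)u, u⟩ equals the pushforward of μ under u ↦ ⟨Au, u⟩. Then all eigenvalues of A are 0; equivalently, the characteristic polynomial of A is X^N and A is nilpotent. (Indeed, it suffices to assume that ∫_{Ω_N} ⟨Au,u⟩^n dμ(u) = 0 for all n ≥ 1.) -/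
open MeasureTheory Matrix

/-- The quadratic form `⟨Au,u⟩ = u*Au = ∑_{i,j} conj(u_i) A_{ij} u_j`. -/
noncomputable def qf {ι : Type*} [Fintype ι] (A : Matrix ι ι ℂ) (u : EuclideanSpace ℂ ι) : ℂ :=
  ∑ i, ∑ j, (starRingEnd ℂ) (u i) * A i j * u j

/-- `μ` is the uniform probability measure on the unit sphere `Ω = {u : ‖u‖ = 1}` of `ℂ^ι`:
a Borel probability measure concentrated on the sphere and invariant under the unitary group. -/
def IsUniformOnSphere {ι : Type*} [Fintype ι] [DecidableEq ι]
    [MeasurableSpace (EuclideanSpace ℂ ι)] [BorelSpace (EuclideanSpace ℂ ι)]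
    (μ : Measure (EuclideanSpace ℂ ι)) : Prop :=
  IsProbabilityMeasure μ ∧ μ (Metric.sphere 0 1) = 1 ∧
    ∀ U ∈ Matrix.unitaryGroup ι ℂ, μ.map (fun u => Matrix.toEuclideanLin U u) = μ

/-- **Schur triangularization**: every operator on a finite-dimensional complex inner product space
is upper triangular in some orthonormal basis. -/
theorem exists_orthonormalBasis_upperTriangular (n : ℕ) {E : Type*} [NormedAddCommGroup E]
    [InnerProductSpace ℂ E] [FiniteDimensional ℂ E] (hn : Module.finrank ℂ E = n)
    (T : E →ₗ[ℂ] E) :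
    ∃ b : OrthonormalBasis (Fin n) ℂ E, ∀ i j, j < i → inner ℂ (b i) (T (b j)) = 0 := by
  induction n generalizing E with
  | zero => exact ⟨(stdOrthonormalBasis ℂ E).reindex (finCongr hn), fun i => i.elim0⟩
  | succ n ih =>
    have : Nontrivial E := Module.nontrivial_of_finrank_pos (R := ℂ) (by omega)
    obtain ⟨c, hc⟩ := Module.End.exists_eigenvalue (LinearMap.adjoint T)
    obtain ⟨v, hv⟩ := hc.exists_hasEigenvector
    obtain ⟨w, hw, hTw⟩ : ∃ w : E, ‖w‖ = 1 ∧ LinearMap.adjoint T w = c • w := by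
      refine ⟨((‖v‖ : ℂ)⁻¹) • v, ?_, ?_⟩
      · simp [norm_smul, hv.2]
      · rw [map_smul, hv.apply_eq_smul, smul_comm]
    have hw0 : w ≠ 0 := by rintro rfl; simp at hw
    let W : Submodule ℂ E := (ℂ ∙ w)ᗮ
    have hWf : Module.finrank ℂ W = n := by
      have : Fact (Module.finrank ℂ E = n + 1) := ⟨hn⟩
      exact Submodule.finrank_orthogonal_span_singleton hw0
    have hW : ∀ x ∈ W, T x ∈ W := by
      intro x hx
      rw [Submodule.mem_orthogonal_singleton_iff_inner_right] at hx ⊢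
      rw [← LinearMap.adjoint_inner_left, hTw, inner_smul_left, hx, mul_zero]
    obtain ⟨b, hb⟩ := ih hWf (T.restrict hW)
    let f : Fin (n + 1) → E := Fin.snoc (fun i => (b i : E)) w
    have hwb : ∀ x : W, inner ℂ w (x : E) = 0 := fun x =>
      Submodule.mem_orthogonal_singleton_iff_inner_right.1 x.2
    have hbw : ∀ x : W, inner ℂ (x : E) w = 0 := fun x =>
      Submodule.mem_orthogonal_singleton_iff_inner_left.1 x.2
    have hf : Orthonormal ℂ f := by
      rw [orthonormal_iff_ite]
      intro i j
      induction i using Fin.lastCases with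
      | last =>
        induction j using Fin.lastCases with
        | last => simp [f, inner_self_eq_norm_sq_to_K, hw]
        | cast j => simp [f, hwb, (Fin.castSucc_lt_last j).ne']
      | cast i =>
        induction j using Fin.lastCases with
        | last => simp [f, hbw, (Fin.castSucc_lt_last i).ne]
        | cast j =>
          have := orthonormal_iff_ite.1 b.orthonormal i j
          simpa [f] using this
    let B := OrthonormalBasis.mk hf
      (hf.linearIndependent.span_eq_top_of_card_eq_finrank' (by simp [hn])).ge
    refine ⟨B, fun i j hij => ?_⟩
    have hB : ∀ i, B i = f i := fun i => by simp [B]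
    rw [hB, hB]
    induction j using Fin.lastCases with
    | last => exact absurd hij (Fin.le_last i).not_gt
    | cast j =>
      induction i using Fin.lastCases with
      | last => simpa [f] using hwb ⟨_, hW _ (b j).2⟩
      | cast i => simpa [f] using hb i j (Fin.castSucc_lt_castSucc_iff.1 hij)

theorem exists_unitary_conjTranspose_mul_mul_isUpperTriangular {N : ℕ}
    (A : Matrix (Fin N) (Fin N) ℂ) :
    ∃ U ∈ Matrix.unitaryGroup (Fin N) ℂ, (Uᴴ * A * U).IsUpperTriangular := by
  obtain ⟨b, hb⟩ := exists_orthonormalBasis_upperTriangular N (by simp)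
    (Matrix.toEuclideanLin A)
  refine ⟨(EuclideanSpace.basisFun (Fin N) ℂ).toBasis.toMatrix b,
    (EuclideanSpace.basisFun (Fin N) ℂ).toMatrix_orthonormalBasis_mem_unitary b,
    fun i j hij => ?_⟩
  rw [← hb i j hij]
  simp [Matrix.mul_apply, Module.Basis.toMatrix_apply, PiLp.inner_apply, Matrix.mulVec, dotProduct,
    Finset.sum_mul]
  rw [Finset.sum_comm]
  refine Finset.sum_congr rfl fun x _ => Finset.sum_congr rfl fun y _ => ?_
  ring

theorem exists_unitary_row_eq {N : ℕ} (i : Fin N) (w : Fin N → ℂ)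
    (hw : ∑ j, ‖w j‖ ^ 2 = 1) :
    ∃ U ∈ Matrix.unitaryGroup (Fin N) ℂ, ∀ j, U i j = w j := by
  let v : EuclideanSpace ℂ (Fin N) := WithLp.toLp 2 (star w)
  have hv : ‖v‖ = 1 := by
    rw [EuclideanSpace.norm_eq]
    simp [v, hw]
  obtain ⟨b, hb⟩ := Orthonormal.exists_orthonormalBasis_extension_of_card_eq (𝕜 := ℂ)
    (E := EuclideanSpace ℂ (Fin N)) (ι := Fin N) (by simp) (v := fun _ => v) (s := {i})
    (by
      rw [orthonormal_iff_ite]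
      rintro ⟨a, rfl⟩ ⟨c, rfl⟩
      simp [inner_self_eq_norm_sq_to_K, hv])
  refine ⟨b.toBasis.toMatrix (EuclideanSpace.basisFun (Fin N) ℂ),
    b.toMatrix_orthonormalBasis_mem_unitary _, fun j => ?_⟩
  simp [Module.Basis.toMatrix_apply, b.repr_apply_apply, hb i rfl, v,
    EuclideanSpace.inner_single_right]

theorem diagonal_mem_unitaryGroup {ι : Type*} [Fintype ι] [DecidableEq ι] {z : ι → ℂ}
    (hz : ∀ i, ‖z i‖ = 1) : Matrix.diagonal z ∈ Matrix.unitaryGroup ι ℂ := by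
  rw [Matrix.mem_unitaryGroup_iff', Matrix.star_eq_conjTranspose, Matrix.diagonal_conjTranspose,
    Matrix.diagonal_mul_diagonal, ← Matrix.diagonal_one]
  congr 1
  ext i
  simp [← Complex.normSq_eq_conj_mul_self, Complex.normSq_eq_norm_sq, hz]

/-- If the complete homogeneous symmetric polynomials of all positive degrees vanish at `l`,
then `l = 0`. -/
theorem forall_eq_zero_of_sum_piAntidiag_eq_zero {ι : Type*} [Fintype ι] [DecidableEq ι]
    (l : ι → ℂ)
    (h : ∀ n, 1 ≤ n → ∑ a ∈ Finset.piAntidiag Finset.univ n, ∏ i, l i ^ a i = 0) (i : ι) :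
    l i = 0 := by
  have hgeom : ∀ i, PowerSeries.mk (fun n => l i ^ n) * (1 - PowerSeries.C (l i) * PowerSeries.X)
      = 1 := by
    intro i
    ext n
    rw [mul_sub, mul_one, ← mul_assoc]
    cases n with
    | zero => simp
    | succ n => simp [PowerSeries.coeff_succ_mul_X, PowerSeries.coeff_one, pow_succ]
  have hprod : ∏ i, PowerSeries.mk (fun n => l i ^ n) = 1 := by
    ext n
    rw [PowerSeries.coeff_prod, PowerSeries.coeff_one]
    split_ifs with hn
    · simp [hn]
    · rw [← h n (by omega)]
      refine Finset.sum_bij (fun a _ => a) (by simp) (by simp) (fun a ha => ?_) (by simp)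
      exact ⟨Finsupp.equivFunOnFinite.symm a, by simpa using ha, by simp⟩
  have hpoly : ∏ i, (1 - Polynomial.C (l i) * Polynomial.X) = 1 := by
    apply Polynomial.coe_injective ℂ
    have := Finset.prod_congr (s₁ := Finset.univ) rfl fun i _ => hgeom i
    rw [Finset.prod_mul_distrib, hprod, one_mul] at this
    rw [← Polynomial.coeToPowerSeries.ringHom_apply, ← Polynomial.coeToPowerSeries.ringHom_apply,
      map_prod]
    simpa using this
  by_contra hi
  have := congrArg (Polynomial.eval (l i)⁻¹) hpoly
  rw [Polynomial.eval_prod, Finset.prod_eq_zero (Finset.mem_univ i) (by simp [hi])] at this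
  simp at this

theorem qf_eq_dotProduct {ι : Type*} [Fintype ι] (A : Matrix ι ι ℂ) (u : EuclideanSpace ℂ ι) :
    qf A u = star (u : ι → ℂ) ⬝ᵥ A *ᵥ (u : ι → ℂ) := by
  simp [qf, dotProduct, Matrix.mulVec, Finset.mul_sum, mul_assoc]

theorem qf_toEuclideanLin {ι : Type*} [Fintype ι] [DecidableEq ι] (A U : Matrix ι ι ℂ)
    (u : EuclideanSpace ℂ ι) :
    qf A (Matrix.toEuclideanLin U u) = qf (Uᴴ * A * U) u := by
  simp [qf_eq_dotProduct, Matrix.star_mulVec, Matrix.dotProduct_mulVec, Matrix.vecMul_vecMul,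
    Matrix.mul_assoc]

theorem continuous_qf {ι : Type*} [Fintype ι] (A : Matrix ι ι ℂ) : Continuous (qf A) := by
  unfold qf
  fun_prop

theorem qf_smul {ι : Type*} [Fintype ι] (c : ℂ) (A : Matrix ι ι ℂ) (u : EuclideanSpace ℂ ι) :
    qf (c • A) u = c * qf A u := by
  simp [qf_eq_dotProduct, Matrix.smul_mulVec]

theorem qf_diagonal {ι : Type*} [Fintype ι] [DecidableEq ι] (l : ι → ℂ)
    (u : EuclideanSpace ℂ ι) :
    qf (Matrix.diagonal l) u = ∑ i, l i * (u i * (starRingEnd ℂ) (u i)) := by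
  simp only [qf, Matrix.diagonal_apply]
  refine Finset.sum_congr rfl fun i _ => ?_
  rw [Finset.sum_eq_single i] <;> simp +contextual [Ne.symm]
  ring

namespace IsUniformOnSphere

variable {N : ℕ} [MeasurableSpace (EuclideanSpace ℂ (Fin N))]
  [BorelSpace (EuclideanSpace ℂ (Fin N))] {μ : Measure (EuclideanSpace ℂ (Fin N))}

theorem ae_mem_sphere (hμ : IsUniformOnSphere μ) :
    ∀ᵐ u ∂μ, u ∈ Metric.sphere (0 : EuclideanSpace ℂ (Fin N)) 1 := by
  have := hμ.1
  exact (prob_compl_eq_zero_iff Metric.isClosed_sphere.measurableSet).2 hμ.2.1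

theorem integrable (hμ : IsUniformOnSphere μ) {f : EuclideanSpace ℂ (Fin N) → ℂ}
    (hf : Continuous f) : Integrable f μ := by
  have := hμ.1
  have h := hf.continuousOn.integrableOn_compact (μ := μ)
    (isCompact_sphere (0 : EuclideanSpace ℂ (Fin N)) 1)
  rwa [IntegrableOn, Measure.restrict_eq_self_of_ae_mem hμ.ae_mem_sphere] at h

theorem integral_toEuclideanLin (hμ : IsUniformOnSphere μ) {U : Matrix (Fin N) (Fin N) ℂ}
    (hU : U ∈ Matrix.unitaryGroup (Fin N) ℂ) {f : EuclideanSpace ℂ (Fin N) → ℂ}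
    (hf : Continuous f) : ∫ u, f (Matrix.toEuclideanLin U u) ∂μ = ∫ u, f u ∂μ := by
  conv_rhs => rw [← hμ.2.2 U hU]
  have hc : Continuous fun u => Matrix.toEuclideanLin U u :=
    (Matrix.toEuclideanLin U).continuous_of_finiteDimensional
  rw [integral_map hc.measurable.aemeasurable hf.aestronglyMeasurable]

/-- Monomials that are not balanced in `u` and `conj u` integrate to zero. -/
theorem integral_monomial_eq_zero (hμ : IsUniformOnSphere μ) {a b : Fin N → ℕ} (hab : a ≠ b) :
    ∫ u, (∏ i, u i ^ a i) * ∏ i, (starRingEnd ℂ) (u i) ^ b i ∂μ = 0 := by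
  wlog h : ∃ k, b k < a k generalizing a b
  · have hba : ∃ k, a k < b k := by
      by_contra! h'
      push Not at h
      exact hab (funext fun k => le_antisymm (h k) (h' k))
    have := congrArg (starRingEnd ℂ) (this hab.symm hba)
    rw [← integral_conj] at this
    simpa [mul_comm] using this
  obtain ⟨k, hk⟩ := h
  obtain ⟨d, hd⟩ := Nat.exists_eq_add_of_lt hk
  let t : ℝ := Real.pi / (d + 1)
  let c : ℂ := Complex.exp (t * Complex.I)
  have hc : ‖c‖ = 1 := Complex.norm_exp_ofReal_mul_I t
  have hcc : c * (starRingEnd ℂ) c = 1 := by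
    rw [Complex.mul_conj, Complex.normSq_eq_norm_sq, hc]; simp
  have hcd : c ^ (d + 1) = -1 := by
    rw [← Complex.exp_nat_mul, ← Complex.exp_pi_mul_I]
    congr 1
    have : (d : ℂ) + 1 ≠ 0 := by exact_mod_cast d.succ_ne_zero
    simp only [t]
    push_cast
    field_simp
  let z : Fin N → ℂ := fun i => if i = k then c else 1
  have hz : ∀ i, ‖z i‖ = 1 := fun i => by
    simp only [z]; split_ifs <;> simp [hc]
  have hint := hμ.integral_toEuclideanLin (diagonal_mem_unitaryGroup hz)
    (f := fun u => (∏ i, u i ^ a i) * ∏ i, (starRingEnd ℂ) (u i) ^ b i) (by fun_prop)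
  have hza : (∏ i, z i ^ a i) * ∏ i, (starRingEnd ℂ) (z i) ^ b i = -1 := by
    rw [Finset.prod_eq_single k, Finset.prod_eq_single k]
    · simp only [z, if_true]
      rw [hd, add_assoc, pow_add, hcd, mul_right_comm, ← mul_pow, hcc]
      simp
    all_goals simp +contextual [z]
  have hmul : ∀ u : EuclideanSpace ℂ (Fin N),
      (∏ i, (Matrix.toEuclideanLin (Matrix.diagonal z) u) i ^ a i) *
        ∏ i, (starRingEnd ℂ) ((Matrix.toEuclideanLin (Matrix.diagonal z) u) i) ^ b i =
      -((∏ i, u i ^ a i) * ∏ i, (starRingEnd ℂ) (u i) ^ b i) := by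
    intro u
    simp only [Matrix.toLpLin_apply, Matrix.mulVec_diagonal, mul_pow, map_mul,
      Finset.prod_mul_distrib]
    linear_combination ((∏ i, u i ^ a i) * ∏ i, (starRingEnd ℂ) (u i) ^ b i) * hza
  simp only [hmul, integral_neg] at hint
  exact self_eq_neg.1 hint.symm

/-- The integral of `(∑ wᵢ uᵢ)ⁿ conj (∑ wᵢ uᵢ)ⁿ` over the sphere, by multinomial expansion. -/
theorem integral_linear_pow (hμ : IsUniformOnSphere μ) (w : Fin N → ℂ) (n : ℕ) :
    ∫ u, (∑ i, w i * u i) ^ n * (starRingEnd ℂ) (∑ i, w i * u i) ^ n ∂μ =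
      ∑ a ∈ Finset.piAntidiag Finset.univ n, (Nat.multinomial Finset.univ a : ℂ) ^ 2 *
        (∫ u, (∏ i, u i ^ a i) * ∏ i, (starRingEnd ℂ) (u i) ^ a i ∂μ) *
        ∏ i, (w i * (starRingEnd ℂ) (w i)) ^ a i := by
  have hexp : ∀ u : EuclideanSpace ℂ (Fin N),
      (∑ i, w i * u i) ^ n * (starRingEnd ℂ) (∑ i, w i * u i) ^ n =
      ∑ a ∈ Finset.piAntidiag Finset.univ n, ∑ b ∈ Finset.piAntidiag Finset.univ n,
        ((Nat.multinomial Finset.univ a : ℂ) * (Nat.multinomial Finset.univ b : ℂ) *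
          ((∏ i, w i ^ a i) * ∏ i, (starRingEnd ℂ) (w i) ^ b i)) *
        ((∏ i, u i ^ a i) * ∏ i, (starRingEnd ℂ) (u i) ^ b i) := by
    intro u
    simp only [map_sum, map_mul, Finset.sum_pow_eq_sum_piAntidiag, Finset.sum_mul_sum, mul_pow,
      Finset.prod_mul_distrib]
    refine Finset.sum_congr rfl fun a _ => Finset.sum_congr rfl fun b _ => ?_
    ring
  simp only [hexp]
  rw [integral_finsetSum _ fun a _ => hμ.integrable (by fun_prop)]
  refine Finset.sum_congr rfl fun a ha => ?_
  rw [integral_finsetSum _ fun b _ => hμ.integrable (by fun_prop), Finset.sum_eq_single a]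
  · rw [integral_const_mul]
    simp only [mul_pow, Finset.prod_mul_distrib]
    ring
  · intro b _ hb
    rw [integral_const_mul, hμ.integral_monomial_eq_zero hb.symm, mul_zero]
  · exact fun h => absurd ha h

/-- The even moments of the coordinates are inversely proportional to multinomial
coefficients. -/
theorem exists_multinomial_mul_integral_eq (hμ : IsUniformOnSphere μ) (hN : 1 ≤ N) (n : ℕ) :
    ∃ K : ℂ, ∀ a ∈ Finset.piAntidiag (Finset.univ : Finset (Fin N)) n,
      (Nat.multinomial Finset.univ a : ℂ) *
        (∫ u, (∏ i, u i ^ a i) * ∏ i, (starRingEnd ℂ) (u i) ^ a i ∂μ) = K := by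
  let k : Fin N := ⟨0, hN⟩
  let m : (Fin N → ℕ) → ℂ := fun a =>
    ∫ u, (∏ i, u i ^ a i) * ∏ i, (starRingEnd ℂ) (u i) ^ a i ∂μ
  let K : ℂ := ∫ u, u k ^ n * (starRingEnd ℂ) (u k) ^ n ∂μ
  refine ⟨K, ?_⟩
  have hunit : ∀ w : Fin N → ℂ, ∑ j, ‖w j‖ ^ 2 = 1 →
      ∑ a ∈ Finset.piAntidiag Finset.univ n, (Nat.multinomial Finset.univ a : ℂ) ^ 2 *
        m a * ∏ i, (w i * (starRingEnd ℂ) (w i)) ^ a i = K := by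
    intro w hw
    obtain ⟨U, hU, hrow⟩ := exists_unitary_row_eq k w hw
    rw [← hμ.integral_linear_pow w n]
    have := hμ.integral_toEuclideanLin hU
      (f := fun u => u k ^ n * (starRingEnd ℂ) (u k) ^ n) (by fun_prop)
    simpa only [Matrix.toLpLin_apply, Matrix.mulVec, dotProduct, hrow] using this
  have hpos : ∀ x : Fin N → ℝ, (∀ i, 0 < x i) →
      ∑ a ∈ Finset.piAntidiag Finset.univ n, (Nat.multinomial Finset.univ a : ℂ) ^ 2 *
        m a * ∏ i, (x i : ℂ) ^ a i = K * (∑ i, (x i : ℂ)) ^ n := by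
    intro x hx
    have hS : 0 < ∑ i, x i := Finset.sum_pos (fun i _ => hx i) ⟨k, Finset.mem_univ k⟩
    have hS' : (∑ i, (x i : ℂ)) ≠ 0 := by exact_mod_cast hS.ne'
    have hsq : ∀ i, Real.sqrt (x i / ∑ i, x i) ^ 2 = x i / ∑ i, x i := fun i =>
      Real.sq_sqrt (div_nonneg (hx i).le hS.le)
    have := hunit (fun i => (Real.sqrt (x i / ∑ i, x i) : ℂ)) (by
      simp only [Complex.norm_real, Real.norm_eq_abs, sq_abs, hsq]
      rw [← Finset.sum_div, div_self hS.ne'])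
    rw [← this, Finset.sum_mul]
    refine Finset.sum_congr rfl fun a ha => ?_
    have han : ∑ i, a i = n := (Finset.mem_piAntidiag.1 ha).1
    rw [mul_assoc _ _ ((∑ i, (x i : ℂ)) ^ n), ← han, ← Finset.prod_pow_eq_pow_sum,
      ← Finset.prod_mul_distrib]
    congr 1
    refine Finset.prod_congr rfl fun i _ => ?_
    rw [← mul_pow, Complex.conj_ofReal, ← sq, ← Complex.ofReal_pow (√_), hsq]
    rw [Complex.ofReal_div, Complex.ofReal_sum, div_mul_cancel₀ _ hS']
  let P : MvPolynomial (Fin N) ℂ := ∑ a ∈ Finset.piAntidiag Finset.univ n,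
    MvPolynomial.monomial (Finsupp.equivFunOnFinite.symm a)
      ((Nat.multinomial Finset.univ a : ℂ) ^ 2 * m a)
  let Q : MvPolynomial (Fin N) ℂ := ∑ a ∈ Finset.piAntidiag Finset.univ n,
    MvPolynomial.monomial (Finsupp.equivFunOnFinite.symm a)
      (K * (Nat.multinomial Finset.univ a : ℂ))
  have hPQ : P = Q := by
    refine MvPolynomial.funext_set (fun _ => Complex.ofReal '' Set.Ioi 0)
      (fun _ => (Set.Ioi_infinite 0).image Complex.ofReal_injective.injOn) fun y hy => ?_
    choose x hx hxy using fun i => hy i (Set.mem_univ i)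
    obtain rfl : (fun i => (x i : ℂ)) = y := funext hxy
    simp only [P, Q, map_sum, MvPolynomial.eval_monomial, Finsupp.prod_fintype, pow_zero,
      implies_true, Finsupp.equivFunOnFinite_symm_apply_apply]
    rw [hpos x hx, Finset.sum_pow_eq_sum_piAntidiag, Finset.mul_sum]
    simp only [mul_assoc]
  intro a ha
  have hcoeff := congrArg (MvPolynomial.coeff (Finsupp.equivFunOnFinite.symm a)) hPQ
  simp only [P, Q, MvPolynomial.coeff_sum, MvPolynomial.coeff_monomial,
    EmbeddingLike.apply_eq_iff_eq, Finset.sum_ite_eq', ha, if_true] at hcoeff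
  have hne : (Nat.multinomial Finset.univ a : ℂ) ≠ 0 := by
    exact_mod_cast (Nat.multinomial_pos _ _).ne'
  apply mul_left_cancel₀ hne
  linear_combination hcoeff

/-- The moments of a diagonal quadratic form are proportional to the complete homogeneous
symmetric polynomials of its diagonal. -/
theorem exists_integral_qf_diagonal_pow (hμ : IsUniformOnSphere μ) (hN : 1 ≤ N) (n : ℕ) :
    ∃ K : ℂ, K ≠ 0 ∧ ∀ l : Fin N → ℂ, ∫ u, qf (Matrix.diagonal l) u ^ n ∂μ =
      K * ∑ a ∈ Finset.piAntidiag Finset.univ n, ∏ i, l i ^ a i := by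
  have := hμ.1
  obtain ⟨K, hK⟩ := hμ.exists_multinomial_mul_integral_eq hN n
  have key : ∀ l : Fin N → ℂ, ∫ u, qf (Matrix.diagonal l) u ^ n ∂μ =
      K * ∑ a ∈ Finset.piAntidiag Finset.univ n, ∏ i, l i ^ a i := by
    intro l
    simp only [qf_diagonal, Finset.sum_pow_eq_sum_piAntidiag, mul_pow, Finset.prod_mul_distrib]
    rw [integral_finsetSum _ fun a _ => hμ.integrable (by fun_prop), Finset.mul_sum]
    refine Finset.sum_congr rfl fun a ha => ?_
    rw [integral_const_mul, integral_const_mul, ← hK a ha]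
    ring
  refine ⟨K, ?_, key⟩
  rintro rfl
  have h1 := key 1
  have hone : ∀ᵐ u ∂μ, qf (Matrix.diagonal 1) u ^ n = 1 := by
    filter_upwards [hμ.ae_mem_sphere] with u hu
    have hu' : ∑ i, ‖u i‖ ^ 2 = 1 := by
      rw [← EuclideanSpace.norm_sq_eq, mem_sphere_zero_iff_norm.1 hu, one_pow]
    have : ∑ i, (u i * (starRingEnd ℂ) (u i)) = 1 := by
      simp only [Complex.mul_conj, Complex.normSq_eq_norm_sq]
      exact_mod_cast hu'
    simp only [qf_diagonal, Pi.one_apply, one_mul, this, one_pow]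
  rw [integral_congr_ae hone] at h1
  simp at h1

theorem integral_qf_conj (hμ : IsUniformOnSphere μ) (A : Matrix (Fin N) (Fin N) ℂ)
    {U : Matrix (Fin N) (Fin N) ℂ} (hU : U ∈ Matrix.unitaryGroup (Fin N) ℂ) (n : ℕ) :
    ∫ u, qf (Uᴴ * A * U) u ^ n ∂μ = ∫ u, qf A u ^ n ∂μ := by
  rw [← hμ.integral_toEuclideanLin hU (f := fun u => qf A u ^ n)
    ((continuous_qf A).pow n)]
  simp only [qf_toEuclideanLin]

/-- Only the diagonal of a triangular matrix contributes to the moments of its quadratic form. -/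
theorem integral_qf_pow_of_isUpperTriangular (hμ : IsUniformOnSphere μ)
    {T : Matrix (Fin N) (Fin N) ℂ} (hT : T.IsUpperTriangular) (n : ℕ) :
    ∫ u, qf T u ^ n ∂μ = ∫ u, qf (Matrix.diagonal T.diag) u ^ n ∂μ := by
  let S : ℂ → Matrix (Fin N) (Fin N) ℂ := fun z =>
    Matrix.of fun i j => z ^ ((j : ℕ) - (i : ℕ)) * T i j
  have hS0 : S 0 = Matrix.diagonal T.diag := by
    ext i j
    rcases lt_trichotomy i j with h | rfl | h
    · have : (j : ℕ) - (i : ℕ) ≠ 0 := (Nat.sub_pos_of_lt h).ne'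
      simp [S, h.ne, this]
    · simp [S]
    · simp [S, hT h, h.ne']
  have hS1 : ∀ z : ℂ, ‖z‖ = 1 → ∫ u, qf (S z) u ^ n ∂μ = ∫ u, qf T u ^ n ∂μ := by
    intro z hz
    have hzz : (starRingEnd ℂ) z * z = 1 := by
      rw [mul_comm, Complex.mul_conj, Complex.normSq_eq_norm_sq, hz]; simp
    rw [← hμ.integral_qf_conj T (diagonal_mem_unitaryGroup (z := fun i : Fin N => z ^ (i : ℕ))
      (by simp [hz])) n]
    congr! 4 with u
    ext i j
    rw [Matrix.diagonal_conjTranspose, Matrix.mul_diagonal, Matrix.diagonal_mul]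
    rcases le_or_gt i j with h | h
    · obtain ⟨d, hd⟩ := Nat.exists_eq_add_of_le (Fin.le_def.1 h)
      simp only [S, Matrix.of_apply, hd, Nat.add_sub_cancel_left, Pi.star_apply, star_pow,
        pow_add, RCLike.star_def]
      have : (starRingEnd ℂ) z ^ (i : ℕ) * z ^ (i : ℕ) = 1 := by rw [← mul_pow, hzz, one_pow]
      linear_combination (- T i j * z ^ d) * this
    · simp [S, hT h]
  let q : Polynomial ℂ := ∑ k ∈ Finset.piAntidiag (Finset.univ : Finset (Fin N × Fin N)) n,
    Polynomial.C ((Nat.multinomial Finset.univ k : ℂ) *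
      ∫ u, ∏ p : Fin N × Fin N, ((starRingEnd ℂ) (u p.1) * T p.1 p.2 * u p.2) ^ k p ∂μ) *
    ∏ p : Fin N × Fin N, (Polynomial.X ^ ((p.2 : ℕ) - (p.1 : ℕ))) ^ k p
  have hq : ∀ z, q.eval z = ∫ u, qf (S z) u ^ n ∂μ := by
    intro z
    have hexp : ∀ u, qf (S z) u ^ n =
        ∑ k ∈ Finset.piAntidiag (Finset.univ : Finset (Fin N × Fin N)) n,
        ((Nat.multinomial Finset.univ k : ℂ) *
          ∏ p : Fin N × Fin N, (z ^ ((p.2 : ℕ) - (p.1 : ℕ))) ^ k p) *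
        ∏ p : Fin N × Fin N, ((starRingEnd ℂ) (u p.1) * T p.1 p.2 * u p.2) ^ k p := by
      intro u
      rw [qf, ← Fintype.sum_prod_type', Finset.sum_pow_eq_sum_piAntidiag]
      refine Finset.sum_congr rfl fun k _ => ?_
      rw [mul_assoc, ← Finset.prod_mul_distrib]
      congr 1
      refine Finset.prod_congr rfl fun p _ => ?_
      rw [← mul_pow]
      congr 1
      simp only [S, Matrix.of_apply]
      ring
    simp only [hexp]
    rw [integral_finsetSum _ fun k _ => hμ.integrable (by fun_prop)]
    simp only [q, Polynomial.eval_finsetSum, Polynomial.eval_mul, Polynomial.eval_C,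
      Polynomial.eval_prod, Polynomial.eval_pow, Polynomial.eval_X, integral_const_mul]
    refine Finset.sum_congr rfl fun k _ => ?_
    ring
  have hinf : Set.Infinite {z : ℂ | ‖z‖ = 1} := by
    have : Infinite (Set.Ioc (-Real.pi) Real.pi) :=
      (Set.Ioc_infinite (by linarith [Real.pi_pos])).to_subtype
    have : Infinite Circle := Infinite.of_injective _ Circle.argEquiv.symm.injective
    refine Set.infinite_of_injective_forall_mem (f := fun z : Circle => (z : ℂ))
      Circle.coe_injective fun z => z.norm_coe
  have hconst : q = Polynomial.C (∫ u, qf T u ^ n ∂μ) := by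
    refine Polynomial.eq_of_infinite_eval_eq _ _ (hinf.mono fun z hz => ?_)
    simp [hq, hS1 z hz]
  rw [← hS0, ← hq, hconst, Polynomial.eval_C]

theorem integral_qf_pow_eq_zero {A : Matrix (Fin N) (Fin N) ℂ}
    (hrot : ∀ θ : ℝ, μ.map (qf (Complex.exp (Complex.I * (θ : ℂ)) • A)) = μ.map (qf A))
    {n : ℕ} (hn : 1 ≤ n) : ∫ u, qf A u ^ n ∂μ = 0 := by
  have hpow : Continuous fun z : ℂ => z ^ n := by fun_prop
  have h := congrArg (fun ν : Measure ℂ => ∫ z, z ^ n ∂ν) (hrot (Real.pi / n))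
  simp only [integral_map (continuous_qf _).measurable.aemeasurable hpow.aestronglyMeasurable,
    qf_smul, mul_pow, integral_const_mul] at h
  have hexp : Complex.exp (Complex.I * ((Real.pi / n : ℝ) : ℂ)) ^ n = -1 := by
    rw [← Complex.exp_nat_mul, ← Complex.exp_pi_mul_I]
    congr 1
    have : (n : ℂ) ≠ 0 := by exact_mod_cast (by omega : n ≠ 0)
    push_cast
    field_simp
  rw [hexp, neg_one_mul] at h
  exact self_eq_neg.1 h.symm

end IsUniformOnSphere

theorem charpoly_eq_X_pow_of_integral_qf_pow_eq_zero {N : ℕ} (hN : 1 ≤ N)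
    (A : Matrix (Fin N) (Fin N) ℂ)
    [MeasurableSpace (EuclideanSpace ℂ (Fin N))] [BorelSpace (EuclideanSpace ℂ (Fin N))]
    {μ : Measure (EuclideanSpace ℂ (Fin N))} (hμ : IsUniformOnSphere μ)
    (h : ∀ n, 1 ≤ n → ∫ u, qf A u ^ n ∂μ = 0) :
    A.charpoly = Polynomial.X ^ N := by
  obtain ⟨U, hU, hT⟩ := exists_unitary_conjTranspose_mul_mul_isUpperTriangular A
  have hdiag : ∀ i, (Uᴴ * A * U).diag i = 0 := by
    refine forall_eq_zero_of_sum_piAntidiag_eq_zero _ fun n hn => ?_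
    obtain ⟨K, hK, hKl⟩ := hμ.exists_integral_qf_diagonal_pow hN n
    have := h n hn
    rw [← hμ.integral_qf_conj A hU n, hμ.integral_qf_pow_of_isUpperTriangular hT, hKl] at this
    exact (mul_eq_zero.1 this).resolve_left hK
  have hUU : U * Uᴴ = 1 := Matrix.mem_unitaryGroup_iff.1 hU
  have hchar : (Uᴴ * A * U).charpoly = A.charpoly := by
    rw [Matrix.mul_assoc, Matrix.charpoly_mul_comm, Matrix.mul_assoc, hUU, Matrix.mul_one]
  rw [← hchar, Matrix.charpoly_of_isUpperTriangular _ hT]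
  simp only [Matrix.diag_apply] at hdiag
  simp [hdiag]

/-- If the numerical shadow of `A` is rotation-invariant, then all eigenvalues of `A` are `0`:
its characteristic polynomial is `X^N` and `A` is nilpotent. -/
theorem stmt_13 (N : ℕ) (hN : 1 ≤ N)
    (A : Matrix (Fin N) (Fin N) ℂ)
    [MeasurableSpace (EuclideanSpace ℂ (Fin N))] [BorelSpace (EuclideanSpace ℂ (Fin N))]
    (μ : Measure (EuclideanSpace ℂ (Fin N))) (hμ : IsUniformOnSphere μ)
    (hrot : ∀ θ : ℝ,
      μ.map (qf (Complex.exp (Complex.I * (θ : ℂ)) • A)) = μ.map (qf A)) :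
    A.charpoly = Polynomial.X ^ N ∧ IsNilpotent A := by
  have hchar := charpoly_eq_X_pow_of_integral_qf_pow_eq_zero hN A hμ fun n hn =>
    IsUniformOnSphere.integral_qf_pow_eq_zero hrot hn
  refine ⟨hchar, N, ?_⟩
  simpa [hchar] using Matrix.aeval_self_charpoly A
end

section
/- Let A be an N×N complex matrix and θ₁ < θ₂ real. Suppose ψ : (θ₁,θ₂) → ℂ^N and λ : (θ₁,θ₂) → ℝ are differentiable with ‖ψ(θ)‖ = 1 and Re(e^{−iθ}A) ψ(θ) = λ(θ) ψ(θ) for all θ ∈ (θ₁,θ₂), where Re(e^{−iθ}A) = (e^{−iθ}A + e^{iθ}A*)/2. Then for every θ ∈ (θ₁,θ₂), ψ(θ)* A ψ(θ) = e^{iθ} (λ(θ) + i λ'(θ)). -/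
open MeasureTheory Matrix

/-- The quadratic form `qf` as a dot product. -/
theorem qf_eq_star_dotProduct_mulVec {ι : Type*} [Fintype ι] (A : Matrix ι ι ℂ)
    (u : EuclideanSpace ℂ ι) :
    qf A u = star (fun i => u i) ⬝ᵥ (A *ᵥ fun i => u i) := by
  simp [qf, dotProduct, mulVec, Finset.mul_sum, mul_assoc]

/-- A unit vector of `EuclideanSpace` has unit dot product with its conjugate. -/
theorem star_dotProduct_self_of_norm_eq_one {ι : Type*} [Fintype ι] (u : EuclideanSpace ℂ ι)
    (hu : ‖u‖ = 1) : star (fun i => u i) ⬝ᵥ (fun i => u i) = 1 := by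
  have h := inner_self_eq_norm_sq_to_K (𝕜 := ℂ) u
  rw [hu, EuclideanSpace.inner_eq_star_dotProduct, dotProduct_comm] at h
  simpa using h

/-- The derivative of a product whose first factor vanishes at the base point. -/
theorem HasDerivAt.mul_differentiableAt_of_eq_zero {f g : ℝ → ℂ} {f' : ℂ} {x : ℝ}
    (hf : HasDerivAt f f' x) (hfx : f x = 0) (hg : DifferentiableAt ℝ g x) :
    HasDerivAt (fun s => f s * g s) (f' * g x) x := by
  simpa [hfx] using hf.fun_mul hg.hasDerivAt

/-- A left eigenvector of a Hermitian matrix for a real eigenvalue, from a right one. -/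
theorem Matrix.IsHermitian.star_dotProduct_mulVec_of_mulVec_eq {ι : Type*} [Fintype ι]
    {H : Matrix ι ι ℂ} (hH : H.IsHermitian) {u : ι → ℂ} {r : ℝ}
    (hu : H *ᵥ u = (r : ℂ) • u) (v : ι → ℂ) :
    star u ⬝ᵥ (H *ᵥ v) = r * (star u ⬝ᵥ v) := by
  rw [dotProduct_mulVec, ← hH.eq, ← star_mulVec, hu]
  simp [star_smul]

/-- The matrix `Re(e^{−iθ}A)` is Hermitian. -/
theorem isHermitian_half_smul_exp (N : ℕ) (A : Matrix (Fin N) (Fin N) ℂ) (θ : ℝ) :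
    ((1 / 2 : ℂ) • (Complex.exp (-(Complex.I * (θ : ℂ))) • A +
      Complex.exp (Complex.I * (θ : ℂ)) • Aᴴ)).IsHermitian := by
  simp [Matrix.IsHermitian, conjTranspose_smul, ← Complex.exp_conj, add_comm]

/-- If `ψ(θ)` is a differentiable family of unit eigenvectors of
`Re(e^{−iθ}A) = (e^{−iθ}A + e^{iθ}A*)/2` with differentiable eigenvalue `λ(θ)`, then the
critical curve satisfies `ψ(θ)* A ψ(θ) = e^{iθ}(λ(θ) + iλ'(θ))`. -/
theorem stmt_18 (N : ℕ) (A : Matrix (Fin N) (Fin N) ℂ)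
    (θ₁ θ₂ : ℝ) (hθ : θ₁ < θ₂)
    (ψ ψ' : ℝ → EuclideanSpace ℂ (Fin N))
    (l l' : ℝ → ℝ)
    (hψd : ∀ θ ∈ Set.Ioo θ₁ θ₂, ∀ i, HasDerivAt (fun s => ψ s i) (ψ' θ i) θ)
    (hld : ∀ θ ∈ Set.Ioo θ₁ θ₂, HasDerivAt l (l' θ) θ)
    (hnorm : ∀ θ ∈ Set.Ioo θ₁ θ₂, ‖ψ θ‖ = 1)
    (heig : ∀ θ ∈ Set.Ioo θ₁ θ₂,
      ((1 / 2 : ℂ) • (Complex.exp (-(Complex.I * (θ : ℂ))) • A +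
          Complex.exp (Complex.I * (θ : ℂ)) • Aᴴ)).mulVec (fun i => ψ θ i)
        = fun i => (l θ : ℂ) * ψ θ i) :
    ∀ θ ∈ Set.Ioo θ₁ θ₂,
      qf A (ψ θ) = Complex.exp (Complex.I * (θ : ℂ)) * ((l θ : ℂ) + Complex.I * (l' θ : ℂ)) := by
  intro θ hθ'
  set v : ℝ → Fin N → ℂ := fun s i => ψ s i with hv
  set w : Fin N → ℂ := star (v θ) with hw
  have hvd : ∀ i, DifferentiableAt ℝ (fun s => v s i) θ :=
    fun i => (hψd θ hθ' i).differentiableAt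
  have had : ∀ B : Matrix (Fin N) (Fin N) ℂ,
      DifferentiableAt ℝ (fun s => w ⬝ᵥ (B *ᵥ v s)) θ := by
    intro B
    simp only [dotProduct, mulVec]
    fun_prop
  have hcd : DifferentiableAt ℝ (fun s => w ⬝ᵥ v s) θ := by
    simp only [dotProduct]
    fun_prop
  have hc : w ⬝ᵥ v θ = 1 := star_dotProduct_self_of_norm_eq_one _ (hnorm θ hθ')
  have hexpand : ∀ (t : ℝ) (x : Fin N → ℂ),
      w ⬝ᵥ (((1 / 2 : ℂ) • (Complex.exp (-(Complex.I * (t : ℂ))) • A +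
        Complex.exp (Complex.I * (t : ℂ)) • Aᴴ)) *ᵥ x) =
      1 / 2 * (Complex.exp (-(Complex.I * t)) * (w ⬝ᵥ (A *ᵥ x)) +
        Complex.exp (Complex.I * t) * (w ⬝ᵥ (Aᴴ *ᵥ x))) := by
    intro t x
    simp only [smul_mulVec, add_mulVec, dotProduct_add, dotProduct_smul, smul_eq_mul]
  have hright : ∀ s ∈ Set.Ioo θ₁ θ₂,
      1 / 2 * (Complex.exp (-(Complex.I * s)) * (w ⬝ᵥ (A *ᵥ v s)) +
        Complex.exp (Complex.I * s) * (w ⬝ᵥ (Aᴴ *ᵥ v s))) = l s * (w ⬝ᵥ v s) := by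
    intro s hs
    rw [← hexpand]
    exact (congrArg (w ⬝ᵥ ·) (heig s hs)).trans (dotProduct_smul (l s : ℂ) w (v s))
  have hleft : ∀ s,
      1 / 2 * (Complex.exp (-(Complex.I * θ)) * (w ⬝ᵥ (A *ᵥ v s)) +
        Complex.exp (Complex.I * θ) * (w ⬝ᵥ (Aᴴ *ᵥ v s))) = l θ * (w ⬝ᵥ v s) := by
    intro s
    rw [← hexpand]
    exact (isHermitian_half_smul_exp N A θ).star_dotProduct_mulVec_of_mulVec_eq
      (heig θ hθ') (v s)
  have hid : HasDerivAt (fun s : ℝ => Complex.I * (s : ℂ)) Complex.I θ := by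
    simpa using (Complex.ofRealCLM.hasDerivAt (x := θ)).const_mul Complex.I
  have hneg := (hid.fun_neg.cexp.sub_const (Complex.exp (-(Complex.I * θ))))
    |>.mul_differentiableAt_of_eq_zero (sub_self _) (had A)
  have hpos := (hid.cexp.sub_const (Complex.exp (Complex.I * θ)))
    |>.mul_differentiableAt_of_eq_zero (sub_self _) (had Aᴴ)
  have hl := ((hld θ hθ').ofReal_comp.sub_const (l θ : ℂ))
    |>.mul_differentiableAt_of_eq_zero (sub_self _) hcd
  have hderiv := ((hneg.fun_add hpos).const_mul (1 / 2 : ℂ)).unique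
    (hl.congr_of_eventuallyEq (by
      filter_upwards [isOpen_Ioo.mem_nhds hθ'] with s hs
      linear_combination hright s hs - hleft s))
  have hval := hleft θ
  rw [hc] at hderiv hval
  have hexp : Complex.exp (Complex.I * θ) * Complex.exp (-(Complex.I * θ)) = 1 := by
    rw [← Complex.exp_add, add_neg_cancel, Complex.exp_zero]
  have hrot : Complex.exp (-(Complex.I * θ)) * (w ⬝ᵥ (A *ᵥ v θ)) = l θ + Complex.I * l' θ := by
    linear_combination hval + Complex.I * hderiv + (1 / 2) * (Complex.exp (-(Complex.I * θ)) *
      (w ⬝ᵥ (A *ᵥ v θ)) - Complex.exp (Complex.I * θ) * (w ⬝ᵥ (Aᴴ *ᵥ v θ))) * Complex.I_sq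
  rw [qf_eq_star_dotProduct_mulVec, ← hrot, ← mul_assoc, hexp, one_mul]
end
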